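/- Suppose condition (B_p) holds for some p > 1 and condition (Q_∞) holds. Then the embedded process (Y_n) is an irreducible Markov chain on ℤ≥0, and: (i) (X_n) is recurrent if and only if (Y_n) is recurrent; (ii) (X_n) is positive-recurrent if and only if (Y_n) is positive-recurrent. -/

import Mathlib

open MeasureTheory Filter Topology Asymptotics
open scoped ENNReal NNReal

/-- A time-homogeneous Markov chain on a measurable state space `E`, encoded via the family
`P z` of laws (on trajectory space) of the chain started at `z`.  The field `markov` is the
time-homogeneous Markov property: conditionally on the event `{ω n = w}` intersected with any
event `B` depending only on the first `n+1` coordinates, the shifted trajectory has law `P w`. -/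
structure MChain (E : Type*) [MeasurableSpace E] where
  P : E → MeasureTheory.Measure (ℕ → E)
  isProb : ∀ z, MeasureTheory.IsProbabilityMeasure (P z)
  init : ∀ z, P z {ω | ω 0 = z} = 1
  markov : ∀ (z : E) (n : ℕ) (w : E) (A B : Set (ℕ → E)), MeasurableSet A →
    (∀ ω ω' : ℕ → E, (∀ k, k ≤ n → ω k = ω' k) → ω ∈ B → ω' ∈ B) →
    P z (B ∩ {ω | ω n = w} ∩ {ω | (fun k => ω (n + k)) ∈ A})
      = P z (B ∩ {ω | ω n = w}) * P w A

namespace MChain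

variable {E : Type*} [MeasurableSpace E]

/-- Irreducibility: every state can be reached from every state with positive probability. -/
def Irreducible (X : MChain E) : Prop := ∀ z w : E, ∃ n : ℕ, X.P z {ω | ω n = w} ≠ 0

/-- Recurrence: from every state, the chain returns to it almost surely. -/
def Recurrent (X : MChain E) : Prop := ∀ z : E, X.P z {ω | ∃ n, 1 ≤ n ∧ ω n = z} = 1

def Transient (X : MChain E) : Prop := ¬ X.Recurrent

/-- The first return time to `z` (with junk value `0`, via `sInf ∅ = 0`, if there is no return). -/
noncomputable def returnTime (z : E) (ω : ℕ → E) : ℕ := sInf {n | 1 ≤ n ∧ ω n = z}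

/-- Positive recurrence: recurrent, with finite mean return times. -/
def PositiveRecurrent (X : MChain E) : Prop :=
  X.Recurrent ∧ ∀ z : E, (∫⁻ ω, (returnTime z ω : ℝ≥0∞) ∂(X.P z)) ≠ ⊤

def NullRecurrent (X : MChain E) : Prop := X.Recurrent ∧ ¬ X.PositiveRecurrent

end MChain

section HalfStrip

variable {S : Type*} [Fintype S] [DecidableEq S] [Nonempty S]
  [MeasurableSpace S] [MeasurableSingletonClass S]

/-- `qhat X x i j` is the probability that the `S`-coordinate moves from `i` to `j` when the
`ℕ`-coordinate is at `x`; this is `q_x(i,j) = Σ_y p(x,i,y,j)` of the paper. -/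
noncomputable def qhat (X : MChain (ℕ × S)) (x : ℕ) (i j : S) : ℝ :=
  (X.P (x, i) {ω | (ω 1).2 = j}).toReal

/-- `stepMoment X k x i = μ_k(x,i) = E[(X_{n+1}-X_n)^k | X_n = x, η_n = i]`. -/
noncomputable def stepMoment (X : MChain (ℕ × S)) (k : ℕ) (x : ℕ) (i : S) : ℝ :=
  ∫ ω, (((ω 1).1 : ℝ) - (x : ℝ)) ^ k ∂(X.P (x, i))

/-- Condition (B_p): uniformly bounded conditional `p`-th moments of the jumps of the
`ℕ`-coordinate (by the Markov property, the conditional moment given `F_n` is a function of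
the current state only). -/
def CondB (X : MChain (ℕ × S)) (p : ℝ) : Prop :=
  ∃ C : ℝ≥0∞, C ≠ ⊤ ∧ ∀ (x : ℕ) (i : S),
    (∫⁻ ω, ENNReal.ofReal (|((ω 1).1 : ℝ) - (x : ℝ)| ^ p) ∂(X.P (x, i))) ≤ C

def IsStochasticMatrix (Q : S → S → ℝ) : Prop :=
  (∀ i j, 0 ≤ Q i j) ∧ ∀ i, (∑ j, Q i j) = 1

def IsIrreducibleMatrix (Q : S → S → ℝ) : Prop :=
  ∀ i j, ∃ n : ℕ, 0 < ((Matrix.of Q) ^ n) i j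

/-- Aperiodicity (for a finite irreducible stochastic matrix, eventual positivity of the
diagonal entries of the powers is equivalent to aperiodicity). -/
def IsAperiodicMatrix (Q : S → S → ℝ) : Prop :=
  ∀ i, ∃ N : ℕ, ∀ n, N ≤ n → 0 < ((Matrix.of Q) ^ n) i i

/-- `pst` is a (strictly positive) stationary distribution for `Q`. -/
def IsStationaryDist (Q : S → S → ℝ) (pst : S → ℝ) : Prop :=
  (∀ i, 0 < pst i) ∧ (∑ i, pst i) = 1 ∧ ∀ j, (∑ i, pst i * Q i j) = pst j

/-- Condition (Q_∞): the transition matrix of the `S`-coordinate converges as `x → ∞` to an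
irreducible stochastic matrix `Q`. -/
def CondQ (X : MChain (ℕ × S)) (Q : S → S → ℝ) : Prop :=
  (∀ i j, Tendsto (fun x : ℕ => qhat X x i j) atTop (nhds (Q i j))) ∧
    IsStochasticMatrix Q ∧ IsIrreducibleMatrix Q

/-- Condition (Q_∞^+): as (Q_∞), with a power-law rate of convergence. -/
def CondQplus (X : MChain (ℕ × S)) (Q : S → S → ℝ) : Prop :=
  (∃ δ₀ : ℝ, 0 < δ₀ ∧ ∀ i j,
      (fun x : ℕ => qhat X x i j - Q i j) =O[atTop] fun x : ℕ => (x : ℝ) ^ (-δ₀)) ∧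
    IsStochasticMatrix Q ∧ IsIrreducibleMatrix Q

/-- Condition (M_C): asymptotically constant drifts, `μ₁(x,i) = d_i + o(1)`. -/
def CondMC (X : MChain (ℕ × S)) (d : S → ℝ) : Prop :=
  ∀ i, Tendsto (fun x : ℕ => stepMoment X 1 x i) atTop (nhds (d i))

/-- Condition (M_L): Lamperti-type drifts, `μ₁(x,i) = c_i/x + o(1/x)`, `μ₂(x,i) = s_i² + o(1)`,
with at least one `s_i²` nonzero. -/
def CondML (X : MChain (ℕ × S)) (c s2 : S → ℝ) : Prop :=
  (∀ i, 0 ≤ s2 i) ∧ (∃ i, s2 i ≠ 0) ∧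
    (∀ i, Tendsto (fun x : ℕ => (x : ℝ) * stepMoment X 1 x i) atTop (nhds (c i))) ∧
    (∀ i, Tendsto (fun x : ℕ => stepMoment X 2 x i) atTop (nhds (s2 i)))

/-- Condition (M_L^+): Lamperti-type drifts with power-law error bounds. -/
def CondMLplus (X : MChain (ℕ × S)) (c s2 : S → ℝ) : Prop :=
  (∀ i, 0 ≤ s2 i) ∧ (∃ i, s2 i ≠ 0) ∧
    ∃ δ₁ : ℝ, 0 < δ₁ ∧ ∀ i,
      ((fun x : ℕ => stepMoment X 1 x i - c i / (x : ℝ)) =O[atTop]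
        fun x : ℕ => (x : ℝ) ^ (-1 - δ₁)) ∧
      ((fun x : ℕ => stepMoment X 2 x i - s2 i) =O[atTop] fun x : ℕ => (x : ℝ) ^ (-δ₁))

/-- Successive visit times `τ_0 < τ_1 < ⋯` of the `S`-coordinate to the distinguished state
`s0` (junk value, via `sInf ∅ = 0`, if there is no such visit). -/
noncomputable def tauSeq (s0 : S) (ω : ℕ → ℕ × S) : ℕ → ℕ
  | 0 => sInf {n | (ω n).2 = s0}
  | m + 1 => sInf {n | tauSeq s0 ω m < n ∧ (ω n).2 = s0}

/-- `τ`, the first positive time at which the `S`-coordinate visits `s0`. -/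
noncomputable def tauRet (s0 : S) (ω : ℕ → ℕ × S) : ℕ :=
  sInf {n | 1 ≤ n ∧ (ω n).2 = s0}

/-- `D_n`, the maximal displacement of the `ℕ`-coordinate during the `n`-th excursion. -/
noncomputable def Dexc (s0 : S) (n : ℕ) (ω : ℕ → ℕ × S) : ℕ :=
  Finset.sup (Finset.Icc (tauSeq s0 ω n) (tauSeq s0 ω (n + 1)))
    fun m => Nat.dist (ω m).1 (ω (tauSeq s0 ω n)).1

/-- `N(n) = max {k : τ_k ≤ n}`. -/
noncomputable def Ncount (s0 : S) (n : ℕ) (ω : ℕ → ℕ × S) : ℕ :=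
  sSup {k | tauSeq s0 ω k ≤ n}

end HalfStrip

/-- `Fdist a t` is the distribution function of the square root of a `Gamma(a,t)` random
variable: `F_{a,t}(x) = ∫_0^x 2 u^{2a-1} e^{-u²/t} / (t^a Γ(a)) du`. -/
noncomputable def Fdist (a t x : ℝ) : ℝ :=
  ∫ u in (0:ℝ)..x, 2 * u ^ (2 * a - 1) * Real.exp (-(u ^ 2) / t) / (t ^ a * Real.Gamma a)

variable {S : Type*} [Fintype S] [DecidableEq S] [Nonempty S]
  [MeasurableSpace S] [MeasurableSingletonClass S]

namespace MChain

lemma mul_le_of_le_add_one_sub_mul {ε g m : ℝ≥0∞} (hε : ε ≤ 1) (hg : g ≠ ⊤)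
    (h : g ≤ m + (1 - ε) * g) : ε * g ≤ m := by
  have h1 : ε * g + (1 - ε) * g ≤ m + (1 - ε) * g := by
    rwa [← add_mul, add_tsub_cancel_of_le hε, one_mul]
  exact ENNReal.le_of_add_le_add_right (ENNReal.mul_ne_top (by simp) hg) h1

section Countable

variable {E : Type*}

/-- The trajectory seen from time `n` on. -/
def shift (n : ℕ) (ω : ℕ → E) : ℕ → E := fun k => ω (n + k)

/-- The event `B` is determined by the coordinates `0, …, n`. -/
def DeterminedBy (n : ℕ) (B : Set (ℕ → E)) : Prop :=
  ∀ ω ω' : ℕ → E, (∀ k, k ≤ n → ω k = ω' k) → ω ∈ B → ω' ∈ B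

/-- The first time `≥ 1` at which the trajectory is in `C`, equal to `⊤` if there is none. -/
noncomputable def hitTime (C : Set E) (ω : ℕ → E) : ℝ≥0∞ :=
  open Classical in ⨅ n : ℕ, if 1 ≤ n ∧ ω n ∈ C then (n : ℝ≥0∞) else ⊤

lemma hitTime_le {C : Set E} {ω : ℕ → E} {n : ℕ} (hn : 1 ≤ n) (h : ω n ∈ C) :
    hitTime C ω ≤ n := by
  classical
  exact (iInf_le _ n).trans (by simp [hn, h])

lemma le_hitTime {C : Set E} {ω : ℕ → E} {c : ℝ≥0∞} (h : ∀ n : ℕ, 1 ≤ n → ω n ∈ C → c ≤ n) :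
    c ≤ hitTime C ω := by
  classical
  refine le_iInf fun n => ?_
  split_ifs with h'
  · exact h n h'.1 h'.2
  · exact le_top

lemma hitTime_eq_top {C : Set E} {ω : ℕ → E} :
    hitTime C ω = ⊤ ↔ ∀ n, 1 ≤ n → ω n ∉ C := by
  constructor
  · intro h n hn hC
    exact absurd (h ▸ hitTime_le hn hC) (by simp)
  · intro h
    exact top_le_iff.1 (le_hitTime fun n hn hC => (h n hn hC).elim)

lemma hitTime_eq {C : Set E} {ω : ℕ → E} {n : ℕ} (hn : 1 ≤ n) (h : ω n ∈ C)
    (hmin : ∀ k, 1 ≤ k → k < n → ω k ∉ C) : hitTime C ω = n := by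
  refine le_antisymm (hitTime_le hn h) (le_hitTime fun k hk hC => ?_)
  by_contra! hlt
  exact hmin k hk (by exact_mod_cast hlt) hC

lemma avoids_or_exists_first (C : Set E) (ω : ℕ → E) :
    (∀ n, 1 ≤ n → ω n ∉ C) ∨
      ∃ k, 1 ≤ k ∧ ω k ∈ C ∧ ∀ j, 1 ≤ j → j < k → ω j ∉ C := by
  classical
  refine or_iff_not_imp_left.2 fun h => ?_
  push Not at h
  exact ⟨Nat.find h, (Nat.find_spec h).1, (Nat.find_spec h).2,
    fun j hj hlt hC => Nat.find_min h hlt ⟨hj, hC⟩⟩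

lemma hitTime_le_add_shift (C : Set E) (ω : ℕ → E) (n : ℕ) :
    hitTime C ω ≤ n + hitTime C (shift n ω) := by
  rcases eq_or_ne (hitTime C (shift n ω)) ⊤ with h | h
  · simp [h]
  obtain ⟨k, hk, hC, hmin⟩ := (avoids_or_exists_first C (shift n ω)).resolve_left
    (mt hitTime_eq_top.2 h)
  rw [hitTime_eq hk hC hmin]
  exact_mod_cast hitTime_le (n := n + k) (by omega) hC

lemma hitTime_shift_le {C : Set E} {ω : ℕ → E} {n : ℕ} (h : ∀ k, 1 ≤ k → k ≤ n → ω k ∉ C) :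
    hitTime C (shift n ω) ≤ hitTime C ω := by
  refine le_hitTime fun k hk hC => ?_
  have hnk : n < k := by
    by_contra! hle
    exact h k hk hle hC
  have h1 : hitTime C (shift n ω) ≤ ((k - n : ℕ) : ℝ≥0∞) :=
    hitTime_le (by omega) (by simpa [shift, Nat.add_sub_cancel' hnk.le] using hC)
  exact h1.trans (by exact_mod_cast Nat.sub_le k n)

lemma returnTime_eq_hitTime {z : E} {ω : ℕ → E} (h : ∃ n, 1 ≤ n ∧ ω n = z) :
    (returnTime z ω : ℝ≥0∞) = hitTime {z} ω := by
  have hs := Nat.sInf_mem (s := {n | 1 ≤ n ∧ ω n = z}) h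
  exact (hitTime_eq hs.1 hs.2 fun k hk hlt hC => Nat.notMem_of_lt_sInf hlt ⟨hk, hC⟩).symm

variable [MeasurableSpace E]

lemma measurable_shift (n : ℕ) : Measurable (shift n : (ℕ → E) → ℕ → E) :=
  measurable_pi_lambda _ fun k => measurable_pi_apply (n + k)

variable (X : MChain E)

lemma lintegral_markov_state (z w : E) (n : ℕ) {B : Set (ℕ → E)} (hB : DeterminedBy n B)
    {f : (ℕ → E) → ℝ≥0∞} (hf : Measurable f) :
    ∫⁻ ω in B ∩ {ω | ω n = w}, f (shift n ω) ∂(X.P z)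
      = X.P z (B ∩ {ω | ω n = w}) * ∫⁻ ω, f ω ∂(X.P w) := by
  have hmap : Measure.map (shift n) ((X.P z).restrict (B ∩ {ω | ω n = w}))
      = X.P z (B ∩ {ω | ω n = w}) • X.P w := by
    ext A hA
    rw [Measure.map_apply (measurable_shift n) hA,
      Measure.restrict_apply (measurable_shift n hA), Set.inter_comm]
    exact X.markov z n w A B hA hB
  rw [← lintegral_map hf (measurable_shift n), hmap, lintegral_smul_measure, smul_eq_mul]

lemma lintegral_le_of_lintegral_min_le {z : E} {f : (ℕ → E) → ℝ≥0∞} (hf : Measurable f)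
    {c : ℝ≥0∞} (h : ∀ L : ℕ, ∫⁻ ω, min (f ω) L ∂(X.P z) ≤ c) : ∫⁻ ω, f ω ∂(X.P z) ≤ c := by
  have hsup : f = fun ω => ⨆ L : ℕ, min (f ω) L := funext fun ω => by
    rw [← inf_iSup_eq, ENNReal.iSup_natCast, inf_top_eq]
  rw [hsup, lintegral_iSup (fun L => hf.min measurable_const)
    (fun L L' hL ω => min_le_min le_rfl (by exact_mod_cast hL))]
  exact iSup_le h

variable [Countable E] [MeasurableSingletonClass E]

lemma DeterminedBy.measurableSet {n : ℕ} {B : Set (ℕ → E)} (hB : DeterminedBy n B) :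
    MeasurableSet B := by
  have hr : Measurable fun (ω : ℕ → E) (k : Fin (n + 1)) => ω k :=
    measurable_pi_lambda _ fun k => measurable_pi_apply _
  have hBe : B = (fun (ω : ℕ → E) (k : Fin (n + 1)) => ω k) ⁻¹'
      ((fun (ω : ℕ → E) (k : Fin (n + 1)) => ω k) '' B) := by
    refine Set.Subset.antisymm (Set.subset_preimage_image _ _) ?_
    rintro ω ⟨ω', hω', h⟩
    exact hB ω' ω (fun k hk => congrFun h ⟨k, by omega⟩) hω'
  rw [hBe]
  exact hr (Set.to_countable _).measurableSet

lemma measurable_coord_set (n : ℕ) (C : Set E) : MeasurableSet {ω : ℕ → E | ω n ∈ C} :=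
  measurable_pi_apply n (Set.to_countable C).measurableSet

lemma measurable_coord_eq (n : ℕ) (w : E) : MeasurableSet {ω : ℕ → E | ω n = w} :=
  measurable_coord_set n {w}

lemma measurable_hitTime (C : Set E) : Measurable (hitTime C) := by
  classical
  refine Measurable.iInf fun n => ?_
  refine Measurable.ite ?_ measurable_const measurable_const
  by_cases hn : 1 ≤ n
  · simpa [hn] using measurable_coord_set n C
  · simp [hn]

lemma lintegral_eq_tsum_state (z : E) (n : ℕ) {B : Set (ℕ → E)} (hB : MeasurableSet B)
    (f : (ℕ → E) → ℝ≥0∞) :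
    ∫⁻ ω in B, f ω ∂(X.P z) = ∑' w : E, ∫⁻ ω in B ∩ {ω | ω n = w}, f ω ∂(X.P z) := by
  rw [← lintegral_iUnion (fun w => hB.inter (measurable_coord_eq n w))]
  · congr 2
    ext ω
    simp
  · intro v w hvw
    refine Set.disjoint_left.2 ?_
    rintro ω ⟨_, h1⟩ ⟨_, h2⟩
    exact hvw (h1.symm.trans h2)

lemma lintegral_markov (z : E) (n : ℕ) {B : Set (ℕ → E)} (hB : DeterminedBy n B)
    {f : (ℕ → E) → ℝ≥0∞} (hf : Measurable f) :
    ∫⁻ ω in B, f (shift n ω) ∂(X.P z)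
      = ∫⁻ ω in B, (∫⁻ ω', f ω' ∂(X.P (ω n))) ∂(X.P z) := by
  rw [X.lintegral_eq_tsum_state z n hB.measurableSet,
    X.lintegral_eq_tsum_state z n hB.measurableSet]
  refine tsum_congr fun w => ?_
  rw [X.lintegral_markov_state z w n hB hf,
    setLIntegral_congr_fun (g := fun _ => ∫⁻ ω', f ω' ∂(X.P w))
      (hB.measurableSet.inter (measurable_coord_eq n w))
      (fun ω hω => by simp only [show ω n = w from hω.2]),
    setLIntegral_const, mul_comm]

lemma lintegral_markov_le (z : E) (n : ℕ) {B : Set (ℕ → E)} (hB : DeterminedBy n B)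
    {f : (ℕ → E) → ℝ≥0∞} (hf : Measurable f) {M : ℝ≥0∞}
    (hM : ∀ ω ∈ B, ∫⁻ ω', f ω' ∂(X.P (ω n)) ≤ M) :
    ∫⁻ ω in B, f (shift n ω) ∂(X.P z) ≤ X.P z B * M := by
  rw [X.lintegral_markov z n hB hf, mul_comm, ← setLIntegral_const]
  exact setLIntegral_mono' hB.measurableSet hM

lemma le_lintegral_markov (z : E) (n : ℕ) {B : Set (ℕ → E)} (hB : DeterminedBy n B)
    {f : (ℕ → E) → ℝ≥0∞} (hf : Measurable f) {M : ℝ≥0∞}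
    (hM : ∀ ω ∈ B, M ≤ ∫⁻ ω', f ω' ∂(X.P (ω n))) :
    X.P z B * M ≤ ∫⁻ ω in B, f (shift n ω) ∂(X.P z) := by
  rw [X.lintegral_markov z n hB hf, mul_comm, ← setLIntegral_const]
  exact setLIntegral_mono' hB.measurableSet hM

lemma ae_shift {z : E} (n : ℕ) {A : Set (ℕ → E)} (hA : MeasurableSet A)
    (h : ∀ w, ∀ᵐ ω ∂(X.P w), ω ∈ A) : ∀ᵐ ω ∂(X.P z), shift n ω ∈ A := by
  have h1 := X.lintegral_markov_le z n (B := Set.univ) (fun _ _ _ _ => trivial)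
    (f := Aᶜ.indicator 1) (measurable_one.indicator hA.compl) (M := 0) (fun ω _ => by
      rw [lintegral_indicator_one hA.compl]
      exact (h (ω n)).le)
  rw [Measure.restrict_univ, mul_zero, nonpos_iff_eq_zero] at h1
  have h2 : ∫⁻ ω, (shift n ⁻¹' Aᶜ).indicator 1 ω ∂(X.P z) = 0 := h1
  rw [lintegral_indicator_one (measurable_shift n hA.compl)] at h2
  exact h2

/-- A uniformly positive chance of reaching `C` within a bounded number of steps makes the
expected hitting time of `C` uniformly bounded. -/
lemma exists_lintegral_hitTime_le (C : Set E) (m : ℕ) {ε : ℝ≥0∞} (hε : ε ≠ 0)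
    (h : ∀ z, ε ≤ X.P z {ω | ∃ k, 1 ≤ k ∧ k ≤ m ∧ ω k ∈ C}) :
    ∃ M : ℝ≥0∞, M ≠ ⊤ ∧ ∀ z, ∫⁻ ω, hitTime C ω ∂(X.P z) ≤ M := by
  have := X.isProb
  by_cases hE : Nonempty E
  swap
  · exact ⟨0, by simp, fun z => (hE ⟨z⟩).elim⟩
  have hε1 : ε ≤ 1 := (h hE.some).trans prob_le_one
  have hεt : ε ≠ ⊤ := ne_top_of_le_ne_top ENNReal.one_ne_top hε1
  set V : Set (ℕ → E) := {ω | ∃ k, 1 ≤ k ∧ k ≤ m ∧ ω k ∈ C} with hVdef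
  have hV : DeterminedBy m V := by
    rintro ω ω' he ⟨k, h1, h2, h3⟩
    exact ⟨k, h1, h2, he k h2 ▸ h3⟩
  have hVc : DeterminedBy m Vᶜ := fun ω ω' he hω hω' =>
    hω (hV ω' ω (fun k hk => (he k hk).symm) hω')
  have hbound : ∀ (L : ℕ) (z : E), ∫⁻ ω, min (hitTime C ω) L ∂(X.P z) ≤ m / ε := by
    intro L
    set g : ℝ≥0∞ := ⨆ z, ∫⁻ ω, min (hitTime C ω) L ∂(X.P z) with hg
    have hgL : g ≤ L := iSup_le fun z => by
      refine (lintegral_mono fun ω => min_le_right _ _).trans ?_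
      simp
    have hgt : g ≠ ⊤ := ne_top_of_le_ne_top (by simp) hgL
    have hmin : Measurable fun ω : ℕ → E => min (hitTime C ω) (L : ℝ≥0∞) :=
      (measurable_hitTime C).min measurable_const
    have hstep : g ≤ m + (1 - ε) * g := iSup_le fun z => by
      have hle : ∀ ω, min (hitTime C ω) (L : ℝ≥0∞)
          ≤ m + Vᶜ.indicator (fun ω => min (hitTime C (shift m ω)) (L : ℝ≥0∞)) ω := by
        intro ω
        by_cases hω : ω ∈ V
        · obtain ⟨k, h1, h2, h3⟩ := hω
          refine (min_le_left _ _).trans ((hitTime_le h1 h3).trans ?_)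
          exact le_add_right (by exact_mod_cast h2)
        · rw [Set.indicator_of_mem (show ω ∈ Vᶜ from hω)]
          rcases le_total (hitTime C (shift m ω)) L with h' | h'
          · rw [min_eq_left h']
            exact (min_le_left _ _).trans (hitTime_le_add_shift C ω m)
          · rw [min_eq_right h']
            exact (min_le_right _ _).trans le_add_self
      calc ∫⁻ ω, min (hitTime C ω) L ∂(X.P z)
          ≤ ∫⁻ ω, (m + Vᶜ.indicator (fun ω => min (hitTime C (shift m ω)) (L : ℝ≥0∞)) ω)
              ∂(X.P z) := lintegral_mono hle
        _ = m + ∫⁻ ω in Vᶜ, min (hitTime C (shift m ω)) (L : ℝ≥0∞) ∂(X.P z) := by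
            rw [lintegral_add_left measurable_const, lintegral_const, measure_univ, mul_one,
              lintegral_indicator hVc.measurableSet]
        _ ≤ m + X.P z Vᶜ * g := by
            gcongr
            exact X.lintegral_markov_le z m hVc hmin fun ω _ =>
              le_iSup (fun z => ∫⁻ ω, min (hitTime C ω) (L : ℝ≥0∞) ∂(X.P z)) (ω m)
        _ ≤ m + (1 - ε) * g := by
            gcongr
            rw [prob_compl_eq_one_sub hV.measurableSet]
            exact tsub_le_tsub_left (h z) 1
    have hεg : ε * g ≤ m := mul_le_of_le_add_one_sub_mul hε1 hgt hstep
    intro z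
    refine (le_iSup (fun z => ∫⁻ ω, min (hitTime C ω) (L : ℝ≥0∞) ∂(X.P z)) z).trans ?_
    rw [ENNReal.le_div_iff_mul_le (Or.inl hε) (Or.inl hεt), mul_comm]
    exact hεg
  refine ⟨m / ε, ENNReal.div_ne_top (by simp) hε, fun z => ?_⟩
  exact X.lintegral_le_of_lintegral_min_le (measurable_hitTime C) fun L => hbound L z

lemma measure_coord_zero {z w : E} (h : z ≠ w) : X.P z {ω | ω 0 = w} = 0 := by
  have := X.isProb
  refine measure_mono_null (t := {ω | ω 0 = z}ᶜ) ?_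
    ((prob_compl_eq_zero_iff (measurable_coord_eq 0 z)).2 (X.init z))
  rintro ω (hω : ω 0 = w) (hz : ω 0 = z)
  exact h (hz.symm.trans hω)

lemma exists_path_avoiding_start (hirr : X.Irreducible) {a b : E} (hab : a ≠ b) :
    ∃ n, 1 ≤ n ∧ X.P a ({ω | ∀ k, 1 ≤ k → k ≤ n → ω k ≠ a} ∩ {ω | ω n = b}) ≠ 0 := by
  classical
  have hn := Nat.find_spec (hirr a b)
  have hmin : ∀ k < Nat.find (hirr a b), X.P a {ω | ω k = b} = 0 := fun k hk =>
    not_not.1 (Nat.find_min (hirr a b) hk)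
  set n := Nat.find (hirr a b)
  refine ⟨n, ?_, fun h0 => hn ?_⟩
  · by_contra! h
    rw [Nat.lt_one_iff.1 h] at hn
    exact hn (X.measure_coord_zero hab)
  have hk : ∀ k, 1 ≤ k → k ≤ n → X.P a ({ω | ω k = a} ∩ {ω | ω n = b}) = 0 := by
    intro k hk1 hkn
    have hm := X.markov a k a {ω | ω (n - k) = b} Set.univ (measurable_coord_eq _ _)
      (fun _ _ _ _ => trivial)
    rw [hmin (n - k) (by omega), mul_zero, Set.univ_inter] at hm
    refine measure_mono_null ?_ hm
    rintro ω ⟨h1, h2⟩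
    exact ⟨h1, by simpa [Nat.add_sub_cancel' hkn] using h2⟩
  have hU : X.P a (⋃ k : ℕ, ⋃ _ : 1 ≤ k ∧ k ≤ n, {ω | ω k = a} ∩ {ω | ω n = b}) = 0 := by
    simp only [measure_iUnion_null_iff]
    exact fun k h => hk k h.1 h.2
  refine measure_mono_null (fun ω hω => ?_) (measure_union_null h0 hU)
  by_cases hav : ∀ k, 1 ≤ k → k ≤ n → ω k ≠ a
  · exact Or.inl ⟨hav, hω⟩
  · push Not at hav
    obtain ⟨k, h1, h2, h3⟩ := hav
    exact Or.inr (Set.mem_iUnion₂.2 ⟨k, ⟨h1, h2⟩, h3, hω⟩)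

/-- Comparison of a functional `h` that renews at visits to `a` before `b` with a functional `A`
that does not increase under shifts before the first return to `a`. -/
lemma exists_lintegral_le_mul (hirr : X.Irreducible) {a b : E} (hab : a ≠ b) :
    ∃ c : ℝ≥0∞, c ≠ ⊤ ∧ ∀ h A : (ℕ → E) → ℝ≥0∞, Measurable h → Measurable A →
      (∃ L : ℕ, ∀ ω, h ω ≤ L) →
      (∀ ω, h ω ≤ A ω ∨ ∃ k, 1 ≤ k ∧ ω k = a ∧ (∀ j, 1 ≤ j → j < k → ω j ≠ a ∧ ω j ≠ b) ∧
        h ω ≤ A ω + h (shift k ω)) →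
      (∀ ω n, (∀ k, 1 ≤ k → k ≤ n → ω k ≠ a) → A (shift n ω) ≤ A ω) →
      ∫⁻ ω, h ω ∂(X.P b) ≤ c * ∫⁻ ω, A ω ∂(X.P a) := by
  have := X.isProb
  obtain ⟨n, hn1, hδ⟩ := X.exists_path_avoiding_start hirr hab
  set V : Set (ℕ → E) := {ω | ∀ k, 1 ≤ k → k ≤ n → ω k ≠ a} with hVdef
  set D : Set (ℕ → E) := V ∩ {ω | ω n = b} with hDdef
  have hV : DeterminedBy n V := fun ω ω' he hω k h1 h2 => he k h2 ▸ hω k h1 h2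
  have hD : MeasurableSet D := hV.measurableSet.inter (measurable_coord_eq n b)
  refine ⟨(X.P a D)⁻¹ + (X.P a D)⁻¹, by simpa using hδ, ?_⟩
  intro h A hh hA ⟨L, hL⟩ hrenew hmono
  have hδt : X.P a D ≠ ⊤ := measure_ne_top _ _
  have hAb : ∫⁻ ω, A ω ∂(X.P b) ≤ (X.P a D)⁻¹ * ∫⁻ ω, A ω ∂(X.P a) := by
    rw [mul_comm, ← div_eq_mul_inv, ENNReal.le_div_iff_mul_le (Or.inl hδ) (Or.inl hδt), mul_comm,
      ← X.lintegral_markov_state a b n hV hA]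
    refine (setLIntegral_mono' hD fun ω hω => hmono ω n hω.1).trans ?_
    exact setLIntegral_le_lintegral _ _
  set R : ℕ → Set (ℕ → E) := fun k =>
    {ω | 1 ≤ k ∧ (∀ j, 1 ≤ j → j < k → ω j ≠ a ∧ ω j ≠ b)} ∩ {ω | ω k = a} with hRdef
  have hR0 : ∀ k, DeterminedBy k {ω : ℕ → E | 1 ≤ k ∧
      (∀ j, 1 ≤ j → j < k → ω j ≠ a ∧ ω j ≠ b)} := fun k ω ω' he hω =>
    ⟨hω.1, fun j h1 h2 => he j h2.le ▸ hω.2 j h1 h2⟩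
  have hR : ∀ k, MeasurableSet (R k) := fun k =>
    (hR0 k).measurableSet.inter (measurable_coord_eq k a)
  have hRdisj : Pairwise (Function.onFun Disjoint R) := by
    have key : ∀ i j, i < j → ∀ ω, ω ∈ R i → ω ∉ R j := fun i j hij ω h1 h2 =>
      (h2.1.2 i h1.1.1 hij).1 h1.2
    intro i j hij
    refine Set.disjoint_left.2 fun ω h1 h2 => ?_
    rcases hij.lt_or_gt with hlt | hlt
    · exact key i j hlt ω h1 h2
    · exact key j i hlt ω h2 h1
  have hmain : ∀ z, ∫⁻ ω, h ω ∂(X.P z)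
      ≤ ∫⁻ ω, A ω ∂(X.P z) + X.P z (⋃ k, R k) * ∫⁻ ω, h ω ∂(X.P a) := by
    intro z
    have hle : ∀ ω, h ω ≤ A ω + ∑' k, (R k).indicator (fun ω => h (shift k ω)) ω := by
      intro ω
      rcases hrenew ω with h' | ⟨k, hk, hka, hj, hle⟩
      · exact le_add_right h'
      · refine hle.trans (add_le_add_right ?_ _)
        have hmem : ω ∈ R k := ⟨⟨hk, hj⟩, hka⟩
        have := ENNReal.le_tsum (f := fun k => (R k).indicator (fun ω => h (shift k ω)) ω) k
        simpa only [Set.indicator_of_mem hmem] using this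
    have hms : ∀ k, Measurable ((R k).indicator (fun ω => h (shift k ω))) := fun k =>
      (hh.comp (measurable_shift k)).indicator (hR k)
    refine (lintegral_mono hle).trans ?_
    rw [lintegral_add_left hA, lintegral_tsum fun k => (hms k).aemeasurable,
      measure_iUnion hRdisj hR, ← ENNReal.tsum_mul_right]
    refine add_le_add_right (ENNReal.tsum_le_tsum fun k => ?_) _
    rw [lintegral_indicator (hR k), X.lintegral_markov_state z a k (hR0 k) hh]
  have hht : ∀ z, ∫⁻ ω, h ω ∂(X.P z) ≠ ⊤ := fun z =>
    ne_top_of_le_ne_top (b := (L : ℝ≥0∞)) (by simp)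
      ((lintegral_mono hL).trans (by simp))
  have hRD : X.P a (⋃ k, R k) ≤ 1 - X.P a D := by
    rw [← prob_compl_eq_one_sub hD]
    refine measure_mono (Set.iUnion_subset fun k ω hω hωD => ?_)
    rcases lt_or_ge n k with hlt | hge
    · exact (hω.1.2 n hn1 hlt).2 hωD.2
    · exact hωD.1 k hω.1.1 hge hω.2
  have hha : ∫⁻ ω, h ω ∂(X.P a) ≤ (X.P a D)⁻¹ * ∫⁻ ω, A ω ∂(X.P a) := by
    rw [mul_comm, ← div_eq_mul_inv, ENNReal.le_div_iff_mul_le (Or.inl hδ) (Or.inl hδt), mul_comm]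
    refine mul_le_of_le_add_one_sub_mul prob_le_one (hht a) ((hmain a).trans ?_)
    gcongr
  calc ∫⁻ ω, h ω ∂(X.P b)
      ≤ ∫⁻ ω, A ω ∂(X.P b) + 1 * ∫⁻ ω, h ω ∂(X.P a) := by
        refine (hmain b).trans ?_
        gcongr
        exact prob_le_one
    _ ≤ _ := by
        rw [one_mul, add_mul]
        exact add_le_add hAb hha

lemma recurrent_iff : X.Recurrent ↔ ∀ z, ∀ᵐ ω ∂(X.P z), hitTime {z} ω ≠ ⊤ := by
  have := X.isProb
  refine forall_congr' fun z => ?_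
  have hset : {ω : ℕ → E | ∃ n, 1 ≤ n ∧ ω n = z} = {ω | hitTime {z} ω ≠ ⊤} := by
    ext ω
    simp [hitTime_eq_top]
  have hm : MeasurableSet {ω : ℕ → E | hitTime {z} ω ≠ ⊤} :=
    (measurable_hitTime {z}) (measurableSet_singleton ⊤).compl
  rw [hset, ← prob_compl_eq_zero_iff hm]
  rfl

lemma positiveRecurrent_iff :
    X.PositiveRecurrent ↔ ∀ z, ∫⁻ ω, hitTime {z} ω ∂(X.P z) ≠ ⊤ := by
  have hret : X.Recurrent → ∀ z, ∫⁻ ω, (returnTime z ω : ℝ≥0∞) ∂(X.P z)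
      = ∫⁻ ω, hitTime {z} ω ∂(X.P z) := fun hX z => by
    refine lintegral_congr_ae ((X.recurrent_iff.1 hX z).mono fun ω hω => ?_)
    refine returnTime_eq_hitTime ?_
    simpa [hitTime_eq_top] using hω
  constructor
  · exact fun h z => hret h.1 z ▸ h.2 z
  · intro h
    have hX : X.Recurrent := X.recurrent_iff.2 fun z =>
      (ae_lt_top (measurable_hitTime {z}) (h z)).mono fun ω hω => hω.ne
    exact ⟨hX, fun z => (hret hX z).symm ▸ h z⟩

lemma Irreducible.positiveRecurrent {X : MChain E} (hirr : X.Irreducible) (a : E)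
    (ha : ∫⁻ ω, hitTime {a} ω ∂(X.P a) ≠ ⊤) : X.PositiveRecurrent := by
  refine X.positiveRecurrent_iff.2 fun b => ?_
  rcases eq_or_ne a b with rfl | hab
  · exact ha
  obtain ⟨c, hc, hle⟩ := X.exists_lintegral_le_mul hirr hab
  refine ne_top_of_le_ne_top (ENNReal.mul_ne_top hc ha)
    (X.lintegral_le_of_lintegral_min_le (measurable_hitTime {b}) fun L => ?_)
  refine hle (fun ω => min (hitTime {b} ω) L) _
    ((measurable_hitTime {b}).min measurable_const) (measurable_hitTime {a})
    ⟨L, fun ω => min_le_right _ _⟩ (fun ω => ?_) (fun ω n h => hitTime_shift_le h)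
  rcases avoids_or_exists_first {a} ω with h | ⟨k, hk, hka, hmin⟩
  · exact Or.inl (by simp [hitTime_eq_top.2 h])
  by_cases hb : ∃ j, 1 ≤ j ∧ j < k ∧ ω j = b
  · obtain ⟨j, hj, hjk, hjb⟩ := hb
    refine Or.inl ((min_le_left _ _).trans ((hitTime_le hj hjb).trans ?_))
    rw [hitTime_eq hk hka hmin]
    exact_mod_cast hjk.le
  · push Not at hb
    refine Or.inr ⟨k, hk, hka, fun j h1 h2 => ⟨hmin j h1 h2, hb j h1 h2⟩, ?_⟩
    rw [hitTime_eq hk hka hmin]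
    rcases le_total (hitTime {b} (shift k ω)) L with h' | h'
    · rw [min_eq_left h']
      exact (min_le_left _ _).trans (hitTime_le_add_shift {b} ω k)
    · rw [min_eq_right h']
      exact (min_le_right _ _).trans le_add_self

lemma Irreducible.recurrent {X : MChain E} (hirr : X.Irreducible) (a : E)
    (ha : ∀ᵐ ω ∂(X.P a), hitTime {a} ω ≠ ⊤) : X.Recurrent := by
  refine X.recurrent_iff.2 fun b => ?_
  rcases eq_or_ne a b with rfl | hab
  · exact ha
  have hm : ∀ z : E, MeasurableSet {ω : ℕ → E | hitTime {z} ω = ⊤} := fun z =>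
    measurable_hitTime {z} (measurableSet_singleton ⊤)
  obtain ⟨c, -, hle⟩ := X.exists_lintegral_le_mul hirr hab
  have h0 := hle ({ω | hitTime {b} ω = ⊤}.indicator 1) ({ω | hitTime {a} ω = ⊤}.indicator 1)
    (measurable_one.indicator (hm b)) (measurable_one.indicator (hm a))
    ⟨1, Set.indicator_le fun ω _ => by simp⟩ (fun ω => ?_)
    (fun ω n h => ?_)
  · rw [lintegral_indicator_one (hm b), lintegral_indicator_one (hm a),
      show X.P a {ω | hitTime {a} ω = ⊤} = 0 by simpa [ae_iff] using ha, mul_zero,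
      nonpos_iff_eq_zero] at h0
    simpa [ae_iff] using h0
  · by_cases hb : hitTime {b} ω = ⊤
    swap
    · exact Or.inl (by simp [hb])
    rcases avoids_or_exists_first {a} ω with h | ⟨k, hk, hka, hmin⟩
    · exact Or.inl (by simp [hitTime_eq_top.2 h, hb])
    · have hb' := hitTime_eq_top.1 hb
      refine Or.inr ⟨k, hk, hka, fun j h1 h2 => ⟨hmin j h1 h2, hb' j h1⟩, ?_⟩
      have : hitTime {b} (shift k ω) = ⊤ := hitTime_eq_top.2 fun j hj => hb' (k + j) (by omega)
      simp [hb, this]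
  · by_cases ha' : hitTime {a} (shift n ω) = ⊤
    · have : hitTime {a} ω = ⊤ := top_le_iff.1 (ha' ▸ hitTime_shift_le h)
      simp [ha', this]
    · simp [ha']

end Countable

end MChain

section EmbeddedChain

/-- The states in `Z` reach the line `s0` within a common number of steps with a common positive
probability. -/
def UniformlyReaches (X : MChain (ℕ × S)) (s0 : S) (Z : Set (ℕ × S)) : Prop :=
  ∃ (m : ℕ) (ε : ℝ≥0∞), ε ≠ 0 ∧ ∀ z ∈ Z, ε ≤ X.P z {ω | ∃ k, k ≤ m ∧ (ω k).2 = s0}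

omit [Fintype S] [DecidableEq S] [Nonempty S] [MeasurableSingletonClass S] in
lemma UniformlyReaches.iUnion {ι : Type*} [Finite ι] {X : MChain (ℕ × S)} {s0 : S}
    {Z : ι → Set (ℕ × S)} (h : ∀ i, UniformlyReaches X s0 (Z i)) :
    UniformlyReaches X s0 (⋃ i, Z i) := by
  have := Fintype.ofFinite ι
  choose m ε hε hle using h
  refine ⟨Finset.univ.sup m, Finset.univ.inf ε, ?_, fun z hz => ?_⟩
  · rw [← pos_iff_ne_zero, Finset.lt_inf_iff (by simp)]
    exact fun i _ => pos_iff_ne_zero.2 (hε i)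
  · obtain ⟨i, hi⟩ := Set.mem_iUnion.1 hz
    refine (Finset.inf_le (Finset.mem_univ i)).trans ((hle i z hi).trans (measure_mono ?_))
    rintro ω ⟨k, hk, hs⟩
    exact ⟨k, hk.trans (Finset.le_sup (f := m) (Finset.mem_univ i)), hs⟩

omit [DecidableEq S] [Nonempty S] in
lemma tendsto_measure_lt_of_condB (X : MChain (ℕ × S)) {p : ℝ} (hp : 0 < p) (hB : CondB X p)
    (i : S) (x0 : ℕ) :
    Tendsto (fun x : ℕ => X.P (x, i) {ω | (ω 1).1 < x0}) atTop (𝓝 0) := by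
  obtain ⟨C, hC, hle⟩ := hB
  have hlim : Tendsto (fun x : ℕ => C / ENNReal.ofReal (((x : ℝ) - x0) ^ p)) atTop (𝓝 0) := by
    have h1 : Tendsto (fun x : ℕ => ENNReal.ofReal (((x : ℝ) - x0) ^ p)) atTop (𝓝 ⊤) :=
      ENNReal.tendsto_ofReal_atTop.comp ((tendsto_rpow_atTop hp).comp
        (tendsto_atTop_add_const_right _ _ tendsto_natCast_atTop_atTop))
    simpa using ENNReal.Tendsto.const_div h1 (Or.inr hC)
  refine tendsto_of_tendsto_of_tendsto_of_le_of_le' tendsto_const_nhds hlim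
    (Eventually.of_forall fun _ => zero_le) ?_
  filter_upwards [eventually_gt_atTop x0] with x hx
  have hx' : (0 : ℝ) < (x : ℝ) - x0 := by
    rw [sub_pos]; exact_mod_cast hx
  have hpos : 0 < ((x : ℝ) - x0) ^ p := Real.rpow_pos_of_pos hx' p
  rw [ENNReal.le_div_iff_mul_le (Or.inl (by simpa using hpos)) (Or.inl ENNReal.ofReal_ne_top),
    mul_comm, ← setLIntegral_const]
  refine le_trans (setLIntegral_mono' ?_ fun ω hω => ?_)
    ((setLIntegral_le_lintegral _ _).trans (hle x i))
  · exact MChain.measurable_coord_set 1 {z : ℕ × S | z.1 < x0}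
  · have hω' : ((ω 1).1 : ℝ) < x0 := by exact_mod_cast hω
    refine ENNReal.ofReal_le_ofReal (Real.rpow_le_rpow hx'.le ?_ hp.le)
    rw [abs_sub_comm]
    exact (by linarith : (x : ℝ) - x0 ≤ x - (ω 1).1).trans (le_abs_self _)

omit [DecidableEq S] [Nonempty S] in
lemma measurableSet_reaches (s0 : S) (m : ℕ) :
    MeasurableSet {ω : ℕ → ℕ × S | ∃ k, k ≤ m ∧ (ω k).2 = s0} :=
  MChain.DeterminedBy.measurableSet (n := m) fun _ _ he ⟨k, hk, hs⟩ => ⟨k, hk, he k hk ▸ hs⟩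

lemma le_measure_exists_succ (X : MChain (ℕ × S)) (s0 : S) (z : ℕ × S) (W : Set (ℕ × S)) (m : ℕ)
    {ε : ℝ≥0∞} (h : ∀ w ∈ W, ε ≤ X.P w {ω | ∃ k, k ≤ m ∧ (ω k).2 = s0}) :
    X.P z {ω | ω 1 ∈ W} * ε ≤ X.P z {ω | ∃ k, 1 ≤ k ∧ k ≤ m + 1 ∧ (ω k).2 = s0} := by
  have hm := measurableSet_reaches s0 m
  have hW : MChain.DeterminedBy 1 {ω : ℕ → ℕ × S | ω 1 ∈ W} := fun ω ω' he hω => by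
    simpa [← he 1 le_rfl] using hω
  have h1 := X.le_lintegral_markov z 1 hW
    (f := {ω | ∃ k, k ≤ m ∧ (ω k).2 = s0}.indicator 1) (measurable_one.indicator hm) (M := ε)
    (fun ω hω => by
      rw [lintegral_indicator_one hm]
      exact h _ hω)
  refine h1.trans ((setLIntegral_le_lintegral _ _).trans ?_)
  have h2 : ∫⁻ ω, (MChain.shift 1 ⁻¹' {ω | ∃ k, k ≤ m ∧ (ω k).2 = s0}).indicator 1 ω ∂(X.P z)
      ≤ X.P z {ω | ∃ k, 1 ≤ k ∧ k ≤ m + 1 ∧ (ω k).2 = s0} := by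
    rw [lintegral_indicator_one (MChain.measurable_shift 1 hm)]
    refine measure_mono ?_
    rintro ω ⟨k, hk, hs⟩
    exact ⟨1 + k, by omega, by omega, hs⟩
  exact h2

lemma exists_uniformlyReaches_ge (X : MChain (ℕ × S)) (s0 : S) {p : ℝ} (hp : 0 < p)
    (hB : CondB X p) {Q : S → S → ℝ} (hQ : CondQ X Q) (n : ℕ) :
    ∀ i, 0 < ((Matrix.of Q) ^ n) i s0 →
      ∃ x0 : ℕ, UniformlyReaches X s0 {z | z.2 = i ∧ x0 ≤ z.1} := by
  have := X.isProb
  induction n with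
  | zero =>
    intro i hi
    have hi0 : i = s0 := by
      by_contra hne
      simp [Matrix.one_apply_ne hne] at hi
    subst hi0
    refine ⟨0, 0, 1, one_ne_zero, ?_⟩
    rintro ⟨x, j⟩ ⟨rfl, -⟩
    rw [← X.init (x, j)]
    refine measure_mono ?_
    rintro ω (hω : ω 0 = _)
    exact ⟨0, le_rfl, by rw [hω]⟩
  | succ n ih =>
    intro i hi
    obtain ⟨j, hQj, hj⟩ : ∃ j, 0 < Q i j ∧ 0 < ((Matrix.of Q) ^ n) j s0 := by
      by_contra! hcon
      rw [pow_succ', Matrix.mul_apply] at hi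
      refine absurd hi (not_lt.2 (Finset.sum_nonpos fun j _ => ?_))
      rcases (hQ.2.1.1 i j).eq_or_lt with h | h
      · simp [← h]
      · exact mul_nonpos_of_nonneg_of_nonpos h.le (hcon j h)
    obtain ⟨x0, m, ε, hε, hle⟩ := ih j hj
    have hq : ∀ᶠ x : ℕ in atTop, Q i j / 2 < qhat X x i j :=
      (hQ.1 i j).eventually (lt_mem_nhds (half_lt_self hQj))
    have hsmall : ∀ᶠ x : ℕ in atTop,
        X.P (x, i) {ω | (ω 1).1 < x0} < ENNReal.ofReal (Q i j / 4) :=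
      (tendsto_measure_lt_of_condB X hp hB i x0).eventually
        (gt_mem_nhds (ENNReal.ofReal_pos.2 (by positivity)))
    obtain ⟨x1, hx1⟩ := eventually_atTop.1 (hq.and hsmall)
    refine ⟨x1, m + 1, ENNReal.ofReal (Q i j / 4) * ε,
      mul_ne_zero (ENNReal.ofReal_pos.2 (by positivity)).ne' hε, ?_⟩
    rintro ⟨x, i'⟩ ⟨rfl, hx⟩
    obtain ⟨h1, h2⟩ := hx1 x hx
    refine le_trans ?_ ((le_measure_exists_succ X s0 (x, i') _ m hle).trans (measure_mono ?_))
    · gcongr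
      have h3 : ENNReal.ofReal (Q i' j / 2) ≤ X.P (x, i') {ω | (ω 1).2 = j} :=
        ENNReal.ofReal_le_of_le_toReal h1.le
      have h4 : X.P (x, i') {ω | (ω 1).2 = j} ≤
          X.P (x, i') {ω | ω 1 ∈ {z : ℕ × S | z.2 = j ∧ x0 ≤ z.1}}
            + X.P (x, i') {ω | (ω 1).1 < x0} := by
        refine (measure_mono fun ω hω => ?_).trans (measure_union_le _ _)
        rcases lt_or_ge (ω 1).1 x0 with h | h
        · exact Or.inr h
        · exact Or.inl ⟨hω, h⟩
      have h5 : ENNReal.ofReal (Q i' j / 2)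
          = ENNReal.ofReal (Q i' j / 4) + ENNReal.ofReal (Q i' j / 4) := by
        rw [← ENNReal.ofReal_add (by positivity) (by positivity)]
        ring_nf
      rw [h5] at h3
      exact ENNReal.le_of_add_le_add_right ENNReal.ofReal_ne_top
        (h3.trans (h4.trans (add_le_add_right h2.le _)))
    · rintro ω ⟨k, -, hk, hs⟩
      exact ⟨k, hk, hs⟩

lemma uniformlyReaches_univ (X : MChain (ℕ × S)) (hirr : X.Irreducible) (s0 : S) {p : ℝ}
    (hp : 0 < p) (hB : CondB X p) {Q : S → S → ℝ} (hQ : CondQ X Q) :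
    UniformlyReaches X s0 Set.univ := by
  have hline : ∀ i, UniformlyReaches X s0 {z | z.2 = i} := by
    intro i
    obtain ⟨n, hn⟩ := hQ.2.2 i s0
    obtain ⟨x0, hx0⟩ := exists_uniformlyReaches_ge X s0 hp hB hQ n i hn
    have hfin : ∀ x : Fin x0, UniformlyReaches X s0 {((x : ℕ), i)} := by
      intro x
      obtain ⟨m, hm⟩ := hirr (x, i) (0, s0)
      refine ⟨m, _, hm, ?_⟩
      rintro z rfl
      refine measure_mono fun ω hω => ⟨m, le_rfl, ?_⟩
      rw [show ω m = (0, s0) from hω]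
    have hU : UniformlyReaches X s0 (⋃ o : Option (Fin x0),
        o.elim {z | z.2 = i ∧ x0 ≤ z.1} fun x => {((x : ℕ), i)}) := by
      refine UniformlyReaches.iUnion fun o => ?_
      cases o with
      | none => exact hx0
      | some x => exact hfin x
    obtain ⟨m, ε, hε, hle⟩ := hU
    refine ⟨m, ε, hε, ?_⟩
    rintro ⟨x, j⟩ rfl
    refine hle _ (Set.mem_iUnion.2 ?_)
    rcases lt_or_ge x x0 with h | h
    · exact ⟨some ⟨x, h⟩, rfl⟩
    · exact ⟨none, rfl, h⟩
  obtain ⟨m, ε, hε, hle⟩ := UniformlyReaches.iUnion hline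
  exact ⟨m, ε, hε, fun z _ => hle z (Set.mem_iUnion.2 ⟨z.2, rfl⟩)⟩

/-- The expected time to visit the line `s0` is bounded uniformly in the starting state. -/
lemma exists_lintegral_hitTime_line_le (X : MChain (ℕ × S)) (hirr : X.Irreducible) (s0 : S)
    {p : ℝ} (hp : 0 < p) (hB : CondB X p) {Q : S → S → ℝ} (hQ : CondQ X Q) :
    ∃ M : ℝ≥0∞, M ≠ ⊤ ∧ ∀ z, ∫⁻ ω, MChain.hitTime {w | w.2 = s0} ω ∂(X.P z) ≤ M := by
  have := X.isProb
  obtain ⟨m, ε, hε, hle⟩ := uniformlyReaches_univ X hirr s0 hp hB hQ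
  refine X.exists_lintegral_hitTime_le _ (m + 1) hε fun z => ?_
  simpa using le_measure_exists_succ X s0 z Set.univ m hle

/-- Trajectories visiting the line `s0` infinitely often. -/
def visitsInfinitelyOften (s0 : S) : Set (ℕ → ℕ × S) := {ω | ∀ n, ∃ k, n < k ∧ (ω k).2 = s0}

/-- The `ℕ`-coordinate observed at the successive visits to the line `s0`. -/
noncomputable def embed (s0 : S) (ω : ℕ → ℕ × S) (n : ℕ) : ℕ := (ω (tauSeq s0 ω n)).1

section Trajectory

variable {S : Type*} {s0 : S} {ω ω' : ℕ → ℕ × S}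

lemma tauSeq_zero_le {n : ℕ} (h : (ω n).2 = s0) : tauSeq s0 ω 0 ≤ n :=
  Nat.sInf_le (s := {n | (ω n).2 = s0}) h

lemma tauSeq_zero (h : (ω 0).2 = s0) : tauSeq s0 ω 0 = 0 := Nat.le_zero.1 (tauSeq_zero_le h)

lemma tauSeq_succ_le {m n : ℕ} (hn : tauSeq s0 ω m < n) (h : (ω n).2 = s0) :
    tauSeq s0 ω (m + 1) ≤ n :=
  Nat.sInf_le (s := {n | tauSeq s0 ω m < n ∧ (ω n).2 = s0}) ⟨hn, h⟩

lemma tauSeq_succ_mem (hω : ω ∈ visitsInfinitelyOften s0) (m : ℕ) :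
    tauSeq s0 ω m < tauSeq s0 ω (m + 1) ∧ (ω (tauSeq s0 ω (m + 1))).2 = s0 :=
  Nat.sInf_mem (s := {n | tauSeq s0 ω m < n ∧ (ω n).2 = s0}) (hω _)

lemma tauSeq_strictMono (hω : ω ∈ visitsInfinitelyOften s0) : StrictMono (tauSeq s0 ω) :=
  strictMono_nat_of_lt_succ fun m => (tauSeq_succ_mem hω m).1

lemma tauSeq_mem (hω : ω ∈ visitsInfinitelyOften s0) (m : ℕ) :
    (ω (tauSeq s0 ω m)).2 = s0 := by
  cases m with
  | zero =>
    obtain ⟨k, -, hk⟩ := hω 0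
    exact Nat.sInf_mem (s := {n | (ω n).2 = s0}) ⟨k, hk⟩
  | succ m => exact (tauSeq_succ_mem hω m).2

lemma tauSeq_congr (hω : ω ∈ visitsInfinitelyOften s0) (hω' : ω' ∈ visitsInfinitelyOften s0)
    {k : ℕ} (h : ∀ j, j ≤ k → ω j = ω' j) (m : ℕ) (hm : tauSeq s0 ω' m ≤ k) :
    tauSeq s0 ω m = tauSeq s0 ω' m := by
  induction m with
  | zero =>
    have h1 : tauSeq s0 ω 0 ≤ tauSeq s0 ω' 0 := tauSeq_zero_le (h _ hm ▸ tauSeq_mem hω' 0)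
    exact le_antisymm h1 (tauSeq_zero_le (h _ (h1.trans hm) ▸ tauSeq_mem hω 0))
  | succ m ih =>
    obtain ⟨h1, h2⟩ := tauSeq_succ_mem hω' m
    obtain ⟨h3, h4⟩ := tauSeq_succ_mem hω m
    have hi := ih (h1.le.trans hm)
    have h5 : tauSeq s0 ω (m + 1) ≤ tauSeq s0 ω' (m + 1) :=
      tauSeq_succ_le (hi ▸ h1) (h _ hm ▸ h2)
    exact le_antisymm h5 (tauSeq_succ_le (hi ▸ h3) (h _ (h5.trans hm) ▸ h4))

lemma shift_mem_visitsInfinitelyOften (hω : ω ∈ visitsInfinitelyOften s0) (n : ℕ) :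
    MChain.shift n ω ∈ visitsInfinitelyOften s0 := by
  intro m
  obtain ⟨k, hk, hs⟩ := hω (n + m)
  exact ⟨k - n, by omega, by simpa [MChain.shift, Nat.add_sub_cancel' (by omega : n ≤ k)] using hs⟩

lemma tauSeq_add (hω : ω ∈ visitsInfinitelyOften s0) (n m : ℕ) :
    tauSeq s0 ω (n + m)
      = tauSeq s0 ω n + tauSeq s0 (MChain.shift (tauSeq s0 ω n) ω) m := by
  have hsh := shift_mem_visitsInfinitelyOften hω (tauSeq s0 ω n)
  induction m with
  | zero => rw [tauSeq_zero (by simpa [MChain.shift] using tauSeq_mem hω n)]; rfl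
  | succ m ih =>
    obtain ⟨h1, h2⟩ := tauSeq_succ_mem hω (n + m)
    obtain ⟨h3, h4⟩ := tauSeq_succ_mem hsh m
    refine le_antisymm (tauSeq_succ_le (m := n + m) (by omega) h4) ?_
    have h5 : tauSeq s0 (MChain.shift (tauSeq s0 ω n) ω) (m + 1)
        ≤ tauSeq s0 ω (n + m + 1) - tauSeq s0 ω n := by
      refine tauSeq_succ_le (by omega) ?_
      simpa [MChain.shift, Nat.add_sub_cancel' (by omega :
        tauSeq s0 ω n ≤ tauSeq s0 ω (n + m + 1))] using h2
    have h6 : tauSeq s0 ω (n + (m + 1)) = tauSeq s0 ω (n + m + 1) := rfl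
    omega

lemma embed_shift (hω : ω ∈ visitsInfinitelyOften s0) (n : ℕ) :
    embed s0 (MChain.shift (tauSeq s0 ω n) ω) = MChain.shift n (embed s0 ω) := by
  funext m
  simp only [embed, MChain.shift, tauSeq_add hω n m]

lemma exists_tauSeq_eq (hω : ω ∈ visitsInfinitelyOften s0) {n : ℕ} (h : (ω n).2 = s0) :
    ∃ m, m ≤ n ∧ tauSeq s0 ω m = n := by
  classical
  have hex : ∃ m, n ≤ tauSeq s0 ω m := ⟨n, (tauSeq_strictMono hω).le_apply⟩
  have hle := Nat.find_spec hex
  have hmin : ∀ m < Nat.find hex, tauSeq s0 ω m < n := fun m hm => not_le.1 (Nat.find_min hex hm)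
  set m := Nat.find hex
  have heq : tauSeq s0 ω m = n := by
    refine le_antisymm ?_ hle
    cases hm : m with
    | zero => exact tauSeq_zero_le h
    | succ k => exact tauSeq_succ_le (hmin k (by omega)) h
  exact ⟨m, heq ▸ (tauSeq_strictMono hω).le_apply, heq⟩

lemma hitTime_embed_le (hω : ω ∈ visitsInfinitelyOften s0) {x : ℕ} (h0 : ω 0 = (x, s0)) :
    MChain.hitTime {x} (embed s0 ω) ≤ MChain.hitTime {(x, s0)} ω := by
  refine MChain.le_hitTime fun n hn hx => ?_
  obtain ⟨m, hm, heq⟩ := exists_tauSeq_eq hω (n := n) (by rw [show ω n = _ from hx])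
  have hm1 : 1 ≤ m := by
    by_contra! hlt
    rw [Nat.lt_one_iff.1 hlt, tauSeq_zero (by rw [h0])] at heq
    omega
  have hmem : embed s0 ω m ∈ ({x} : Set ℕ) := by
    simp [embed, heq, show ω n = _ from hx]
  exact (MChain.hitTime_le hm1 hmem).trans (by exact_mod_cast hm)

lemma hitTime_le_tauSeq (hω : ω ∈ visitsInfinitelyOften s0) {x n : ℕ} (hn : 1 ≤ n)
    (hx : embed s0 ω n = x) : MChain.hitTime {(x, s0)} ω ≤ tauSeq s0 ω n :=
  MChain.hitTime_le (hn.trans (tauSeq_strictMono hω).le_apply)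
    (Prod.ext hx (tauSeq_mem hω n))

lemma tauSeq_succ_le_add_hitTime (m : ℕ) :
    (tauSeq s0 ω (m + 1) : ℝ≥0∞) ≤ tauSeq s0 ω m
      + MChain.hitTime {w | w.2 = s0} (MChain.shift (tauSeq s0 ω m) ω) := by
  rcases MChain.avoids_or_exists_first {w : ℕ × S | w.2 = s0}
    (MChain.shift (tauSeq s0 ω m) ω) with h | ⟨k, hk, hC, hmin⟩
  · simp [MChain.hitTime_eq_top.2 h]
  · rw [MChain.hitTime_eq hk hC hmin]
    have h1 : tauSeq s0 ω (m + 1) ≤ tauSeq s0 ω m + k := tauSeq_succ_le (by omega) hC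
    exact_mod_cast h1

lemma tauSeq_le_sum_hitTime (h0 : (ω 0).2 = s0) (n : ℕ) :
    (tauSeq s0 ω n : ℝ≥0∞) ≤ ∑ m ∈ Finset.range n,
      MChain.hitTime {w | w.2 = s0} (MChain.shift (tauSeq s0 ω m) ω) := by
  induction n with
  | zero => simp [tauSeq_zero h0]
  | succ n ih =>
    rw [Finset.sum_range_succ]
    exact (tauSeq_succ_le_add_hitTime n).trans (add_le_add_left ih _)

/-- Decomposition of a return to `(x, s0)` along the visits to the line `s0` that precede the
return of the embedded trajectory to `x`. -/
lemma hitTime_le_tsum (hω : ω ∈ visitsInfinitelyOften s0) {x : ℕ} (h0 : (ω 0).2 = s0) :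
    MChain.hitTime {(x, s0)} ω ≤ ∑' m : ℕ,
      {ω | ∀ j, 1 ≤ j → j ≤ m → embed s0 ω j ≠ x}.indicator
        (fun ω => MChain.hitTime {w | w.2 = s0} (MChain.shift (tauSeq s0 ω m) ω)) ω := by
  have key : ∀ n, (∀ j, 1 ≤ j → j < n → embed s0 ω j ≠ x) →
      (tauSeq s0 ω n : ℝ≥0∞) ≤ ∑' m : ℕ,
      {ω | ∀ j, 1 ≤ j → j ≤ m → embed s0 ω j ≠ x}.indicator
        (fun ω => MChain.hitTime {w | w.2 = s0} (MChain.shift (tauSeq s0 ω m) ω)) ω := by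
    intro n hn
    refine (tauSeq_le_sum_hitTime h0 n).trans (le_trans (Finset.sum_le_sum fun m hm => ?_)
      (ENNReal.sum_le_tsum (Finset.range n)))
    have hmem : ω ∈ {ω | ∀ j, 1 ≤ j → j ≤ m → embed s0 ω j ≠ x} := fun j h1 h2 =>
      hn j h1 (h2.trans_lt (Finset.mem_range.1 hm))
    rw [Set.indicator_of_mem hmem]
  rcases MChain.avoids_or_exists_first {x} (embed s0 ω) with h | ⟨n, hn, hx, hmin⟩
  · refine le_top.trans (top_le_iff.2 (ENNReal.eq_top_of_forall_nnreal_le fun r => ?_))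
    obtain ⟨n, hr⟩ := exists_nat_ge r
    refine le_trans ?_ (key n fun j hj _ => h j hj)
    have h1 : (r : ℝ≥0∞) ≤ n := by exact_mod_cast hr
    exact h1.trans (by exact_mod_cast (tauSeq_strictMono hω).le_apply)
  · exact (hitTime_le_tauSeq hω hn hx).trans (key n hmin)

end Trajectory

lemma tsum_indicator_le_hitTime (x : ℕ) (y : ℕ → ℕ) :
    ∑' m : ℕ, {y : ℕ → ℕ | ∀ j, 1 ≤ j → j ≤ m → y j ≠ x}.indicator (1 : (ℕ → ℕ) → ℝ≥0∞) y
      ≤ MChain.hitTime {x} y := by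
  refine MChain.le_hitTime fun n hn hx => ?_
  rw [tsum_eq_sum (s := Finset.range n) fun m hm => Set.indicator_of_notMem
    (fun hmem : ∀ j, 1 ≤ j → j ≤ m → y j ≠ x => hmem n hn (by simpa using hm) hx) _]
  refine (Finset.sum_le_sum (g := fun _ => 1) fun m _ => ?_).trans (by simp)
  exact Set.indicator_le (fun _ _ => le_rfl) y

lemma measurable_sInf_nat {Ω : Type*} [MeasurableSpace Ω] {P : ℕ → Ω → Prop}
    (h : ∀ n, MeasurableSet {ω | P n ω}) : Measurable fun ω => sInf {n | P n ω} := by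
  refine measurable_of_Iic fun k => ?_
  have hset : (fun ω => sInf {n | P n ω}) ⁻¹' Set.Iic k
      = (⋃ n, ⋃ _ : n ≤ k, {ω | P n ω}) ∪ ⋂ n, {ω | P n ω}ᶜ := by
    ext ω
    simp only [Set.mem_preimage, Set.mem_Iic, Set.mem_union, Set.mem_iUnion, Set.mem_iInter,
      Set.mem_compl_iff, Set.mem_ofPred_eq, exists_prop]
    constructor
    · intro hk
      by_cases hne : ∃ n, P n ω
      · exact Or.inl ⟨_, hk, Nat.sInf_mem (s := {n | P n ω}) hne⟩
      · exact Or.inr (not_exists.1 hne)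
    · rintro (⟨n, hnk, hn⟩ | hno)
      · exact (Nat.sInf_le (s := {n | P n ω}) hn).trans hnk
      · simp [hno]
  rw [hset]
  exact (MeasurableSet.iUnion fun n => MeasurableSet.iUnion fun _ => h n).union
    (MeasurableSet.iInter fun n => (h n).compl)

omit [DecidableEq S] [Nonempty S] in
lemma measurable_tauSeq (s0 : S) (m : ℕ) : Measurable fun ω => tauSeq s0 ω m := by
  induction m with
  | zero => exact measurable_sInf_nat fun n => MChain.measurable_coord_set n {w : ℕ × S | w.2 = s0}
  | succ m ih =>
    exact measurable_sInf_nat (P := fun n ω => tauSeq s0 ω m < n ∧ (ω n).2 = s0) fun n =>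
      (measurableSet_lt ih measurable_const).inter
        (MChain.measurable_coord_set n {w : ℕ × S | w.2 = s0})

lemma measurable_shift_tauSeq (s0 : S) (m : ℕ) :
    Measurable fun ω : ℕ → ℕ × S => MChain.shift (tauSeq s0 ω m) ω := by
  have h : Measurable fun q : ℕ × (ℕ → ℕ × S) => MChain.shift q.1 q.2 :=
    measurable_from_prod_countable_right fun n => MChain.measurable_shift n
  exact h.comp ((measurable_tauSeq s0 m).prodMk measurable_id)

lemma measurable_embed (s0 : S) : Measurable (embed s0) := by
  refine measurable_pi_lambda _ fun n => ?_
  exact measurable_fst.comp ((measurable_pi_apply 0).comp (measurable_shift_tauSeq s0 n))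

variable (X : MChain (ℕ × S)) {s0 : S}

/-- The strong Markov property at the successive visits to the line `s0`. -/
lemma lintegral_embed_markov 
    (hG : ∀ z, ∀ᵐ ω ∂(X.P z), ω ∈ visitsInfinitelyOften s0)
    (z : ℕ × S) (n w : ℕ) {B : Set (ℕ → ℕ)}
    (hB : MChain.DeterminedBy n B) {f : (ℕ → ℕ × S) → ℝ≥0∞} (hf : Measurable f) :
    ∫⁻ ω in embed s0 ⁻¹' (B ∩ {y | y n = w}), f (MChain.shift (tauSeq s0 ω n) ω) ∂(X.P z)
      = X.P z (embed s0 ⁻¹' (B ∩ {y | y n = w})) * ∫⁻ ω, f ω ∂(X.P (w, s0)) := by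
  set V := embed s0 ⁻¹' (B ∩ {y | y n = w}) with hVdef
  have hV : MeasurableSet V :=
    measurable_embed s0 (hB.measurableSet.inter (MChain.measurable_coord_eq n w))
  have hVk : ∀ k, MeasurableSet (V ∩ {ω | tauSeq s0 ω n = k}) := fun k =>
    hV.inter (measurable_tauSeq s0 n (measurableSet_singleton k))
  have hdisj : Pairwise (Function.onFun Disjoint fun k => V ∩ {ω | tauSeq s0 ω n = k}) := by
    intro i j hij
    refine Set.disjoint_left.2 ?_
    rintro ω ⟨_, h1⟩ ⟨_, h2⟩
    exact hij (h1.symm.trans h2)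
  have hUn : V = ⋃ k, V ∩ {ω | tauSeq s0 ω n = k} := by
    ext ω
    simp
  set W : ℕ → Set (ℕ → ℕ × S) := fun k => {ω | ∃ ω' ∈ visitsInfinitelyOften s0,
    (∀ j, j ≤ k → ω j = ω' j) ∧ tauSeq s0 ω' n = k ∧ embed s0 ω' ∈ B}
  have hW : ∀ k, MChain.DeterminedBy k (W k) := by
    rintro k ω₁ ω₂ he ⟨ω', h1, h2, h3⟩
    exact ⟨ω', h1, fun j hj => (he j hj).symm.trans (h2 j hj), h3⟩
  have hae : ∀ k, (V ∩ {ω | tauSeq s0 ω n = k} : Set (ℕ → ℕ × S)) =ᵐ[X.P z]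
      (W k ∩ {ω | ω k = (w, s0)} : Set (ℕ → ℕ × S)) := by
    intro k
    filter_upwards [hG z] with ω hω
    refine propext ⟨?_, ?_⟩
    · rintro ⟨⟨h1, h2⟩, rfl⟩
      exact ⟨⟨ω, hω, fun _ _ => rfl, rfl, h1⟩, Prod.ext h2 (tauSeq_mem hω n)⟩
    · rintro ⟨⟨ω', hω', he, h1, h2⟩, h3⟩
      have hτ : ∀ m, m ≤ n → tauSeq s0 ω m = tauSeq s0 ω' m := fun m hm =>
        tauSeq_congr hω hω' he m (h1 ▸ (tauSeq_strictMono hω').monotone hm)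
      have hn : tauSeq s0 ω n = k := (hτ n le_rfl).trans h1
      refine ⟨⟨hB _ _ (fun m hm => ?_) h2, ?_⟩, hn⟩
      · have hk : tauSeq s0 ω' m ≤ k := h1 ▸ (tauSeq_strictMono hω').monotone hm
        simp only [embed, hτ m hm, he _ hk]
      · simp only [embed, hn, show ω k = _ from h3, Set.mem_ofPred_eq]
  have hterm : ∀ k, ∫⁻ ω in V ∩ {ω | tauSeq s0 ω n = k},
      f (MChain.shift (tauSeq s0 ω n) ω) ∂(X.P z)
      = X.P z (V ∩ {ω | tauSeq s0 ω n = k}) * ∫⁻ ω, f ω ∂(X.P (w, s0)) := by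
    intro k
    rw [setLIntegral_congr_fun (g := fun ω => f (MChain.shift k ω)) (hVk k)
      (fun ω hω => by simp only [show tauSeq s0 ω n = k from hω.2]),
      setLIntegral_congr (hae k), measure_congr (hae k),
      X.lintegral_markov_state z (w, s0) k (hW k) hf]
  calc ∫⁻ ω in V, f (MChain.shift (tauSeq s0 ω n) ω) ∂(X.P z)
      = ∑' k, ∫⁻ ω in V ∩ {ω | tauSeq s0 ω n = k},
          f (MChain.shift (tauSeq s0 ω n) ω) ∂(X.P z) := by
        rw [← lintegral_iUnion hVk hdisj, ← hUn]
    _ = X.P z V * ∫⁻ ω, f ω ∂(X.P (w, s0)) := by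
        simp_rw [hterm]
        rw [ENNReal.tsum_mul_right, ← measure_iUnion hdisj hVk, ← hUn]

lemma lintegral_embed_markov_le 
    (hG : ∀ z, ∀ᵐ ω ∂(X.P z), ω ∈ visitsInfinitelyOften s0)
    (z : ℕ × S) (n : ℕ) {B : Set (ℕ → ℕ)}
    (hB : MChain.DeterminedBy n B) {f : (ℕ → ℕ × S) → ℝ≥0∞} (hf : Measurable f) {M : ℝ≥0∞}
    (hM : ∀ w, ∫⁻ ω, f ω ∂(X.P w) ≤ M) :
    ∫⁻ ω in embed s0 ⁻¹' B, f (MChain.shift (tauSeq s0 ω n) ω) ∂(X.P z)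
      ≤ X.P z (embed s0 ⁻¹' B) * M := by
  have hUn : embed s0 ⁻¹' B = ⋃ w, embed s0 ⁻¹' (B ∩ {y | y n = w}) := by
    ext ω
    simp
  have hms : ∀ w, MeasurableSet (embed s0 ⁻¹' (B ∩ {y | y n = w})) := fun w =>
    measurable_embed s0 (hB.measurableSet.inter (MChain.measurable_coord_eq n w))
  have hdisj : Pairwise (Function.onFun Disjoint fun w => embed s0 ⁻¹' (B ∩ {y | y n = w})) := by
    intro i j hij
    refine Set.disjoint_left.2 ?_
    rintro ω ⟨_, h1⟩ ⟨_, h2⟩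
    exact hij (h1.symm.trans h2)
  rw [hUn, lintegral_iUnion hms hdisj, measure_iUnion hdisj hms, ← ENNReal.tsum_mul_right]
  refine ENNReal.tsum_le_tsum fun w => ?_
  rw [lintegral_embed_markov X hG z n w hB hf]
  gcongr
  exact hM _

/-- The chain observed at the successive visits to the line `s0`. -/
noncomputable def embeddedChain
    (hG : ∀ z, ∀ᵐ ω ∂(X.P z), ω ∈ visitsInfinitelyOften s0) : MChain ℕ where
  P x := Measure.map (embed s0) (X.P (x, s0))
  isProb x := by
    have := X.isProb (x, s0)
    exact Measure.isProbabilityMeasure_map (measurable_embed s0).aemeasurable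
  init x := by
    have := X.isProb (x, s0)
    rw [Measure.map_apply (measurable_embed s0) (MChain.measurable_coord_eq 0 x)]
    refine le_antisymm prob_le_one ?_
    rw [← X.init (x, s0)]
    refine measure_mono fun ω hω => ?_
    have h0 : ω 0 = (x, s0) := hω
    simp [embed, tauSeq_zero (show (ω 0).2 = s0 by rw [h0]), h0]
  markov x n w A B hA hB := by
    have hBm : MeasurableSet (B ∩ {y : ℕ → ℕ | y n = w}) :=
      (MChain.DeterminedBy.measurableSet hB).inter (MChain.measurable_coord_eq n w)
    have hAm := measurable_embed s0 hA
    have hsA : MeasurableSet (embed s0 ⁻¹' {y | MChain.shift n y ∈ A}) :=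
      measurable_embed s0 (MChain.measurable_shift n hA)
    have h1 := lintegral_embed_markov X hG (x, s0) n w hB
      (f := (embed s0 ⁻¹' A).indicator 1) (measurable_one.indicator hAm)
    rw [lintegral_indicator_one hAm] at h1
    rw [Measure.map_apply (measurable_embed s0) hBm, Measure.map_apply (measurable_embed s0) hA,
      Measure.map_apply (measurable_embed s0) (hBm.inter (show MeasurableSet {y : ℕ → ℕ | (fun k => y (n + k)) ∈ A} from
        MChain.measurable_shift n hA)), ← h1]
    have h2 : ∫⁻ ω in embed s0 ⁻¹' (B ∩ {y | y n = w}),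
        (embed s0 ⁻¹' A).indicator 1 (MChain.shift (tauSeq s0 ω n) ω) ∂(X.P (x, s0))
        = ∫⁻ ω in embed s0 ⁻¹' (B ∩ {y | y n = w}),
        (embed s0 ⁻¹' {y | MChain.shift n y ∈ A}).indicator 1 ω ∂(X.P (x, s0)) := by
      refine lintegral_congr_ae (ae_restrict_of_ae ?_)
      filter_upwards [hG (x, s0)] with ω hω
      exact congrArg (A.indicator (1 : (ℕ → ℕ) → ℝ≥0∞)) (embed_shift hω n)
    rw [h2, lintegral_indicator_one hsA, Measure.restrict_apply hsA, Set.inter_comm]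
    rfl

lemma embeddedChain_irreducible 
    (hG : ∀ z, ∀ᵐ ω ∂(X.P z), ω ∈ visitsInfinitelyOften s0)
    (hirr : X.Irreducible) :
    (embeddedChain X hG).Irreducible := by
  intro x y
  by_contra! hcon
  obtain ⟨n, hn⟩ := hirr (x, s0) (y, s0)
  have hU : X.P (x, s0) (⋃ m, {ω | embed s0 ω m = y}) = 0 := by
    refine measure_iUnion_null fun m => ?_
    rw [← hcon m]
    exact (Measure.map_apply (measurable_embed s0) (MChain.measurable_coord_eq m y)).symm
  refine hn (measure_mono_null_ae ?_ hU)
  filter_upwards [hG (x, s0)] with ω hω (hy : ω n = (y, s0))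
  obtain ⟨m, -, hm⟩ := exists_tauSeq_eq hω (n := n) (by rw [hy])
  exact Set.mem_iUnion.2 ⟨m, by simp [embed, hm, hy]⟩

omit [DecidableEq S] [Nonempty S] in
lemma ae_init (z : ℕ × S) : ∀ᵐ ω ∂(X.P z), ω 0 = z := by
  have := X.isProb
  exact (prob_compl_eq_zero_iff (MChain.measurable_coord_eq 0 z)).2 (X.init z)

lemma recurrent_iff_embeddedChain 
    (hG : ∀ z, ∀ᵐ ω ∂(X.P z), ω ∈ visitsInfinitelyOften s0)
    (hirr : X.Irreducible) :
    X.Recurrent ↔ (embeddedChain X hG).Recurrent := by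
  have hmap : ∀ x, (∀ᵐ y ∂((embeddedChain X hG).P x), MChain.hitTime {x} y ≠ ⊤) ↔
      ∀ᵐ ω ∂(X.P (x, s0)), MChain.hitTime {x} (embed s0 ω) ≠ ⊤ := fun x =>
    ae_map_iff (measurable_embed s0).aemeasurable
      ((MChain.measurable_hitTime {x}) (measurableSet_singleton ⊤).compl)
  rw [MChain.recurrent_iff (embeddedChain X hG)]
  simp only [hmap]
  constructor
  · intro h x
    filter_upwards [X.recurrent_iff.1 h (x, s0), hG (x, s0), ae_init X (x, s0)] with ω h1 h2 h3
    exact ne_top_of_le_ne_top h1 (hitTime_embed_le h2 h3)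
  · intro h
    refine hirr.recurrent (0, s0) ?_
    filter_upwards [h 0, hG (0, s0)] with ω h1 h2
    obtain ⟨k, hk, hx, -⟩ := (MChain.avoids_or_exists_first _ _).resolve_left
      (mt MChain.hitTime_eq_top.2 h1)
    exact ne_top_of_le_ne_top (by simp) (hitTime_le_tauSeq h2 hk hx)

lemma positiveRecurrent_iff_embeddedChain 
    (hG : ∀ z, ∀ᵐ ω ∂(X.P z), ω ∈ visitsInfinitelyOften s0)
    (hirr : X.Irreducible) {M : ℝ≥0∞} (hM : M ≠ ⊤)
    (hle : ∀ z, ∫⁻ ω, MChain.hitTime {w | w.2 = s0} ω ∂(X.P z) ≤ M) :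
    X.PositiveRecurrent ↔ (embeddedChain X hG).PositiveRecurrent := by
  have hmap : ∀ x, ∫⁻ y, MChain.hitTime {x} y ∂((embeddedChain X hG).P x)
      = ∫⁻ ω, MChain.hitTime {x} (embed s0 ω) ∂(X.P (x, s0)) := fun x =>
    lintegral_map (MChain.measurable_hitTime {x}) (measurable_embed s0)
  rw [MChain.positiveRecurrent_iff (embeddedChain X hG)]
  simp only [hmap]
  constructor
  · intro h x
    refine ne_top_of_le_ne_top (X.positiveRecurrent_iff.1 h (x, s0)) (lintegral_mono_ae ?_)
    filter_upwards [hG (x, s0), ae_init X (x, s0)] with ω h2 h3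
    exact hitTime_embed_le h2 h3
  · intro h
    refine hirr.positiveRecurrent (0, s0) (ne_top_of_le_ne_top (ENNReal.mul_ne_top (h 0) hM) ?_)
    set B : ℕ → Set (ℕ → ℕ) := fun m => {y | ∀ j, 1 ≤ j → j ≤ m → y j ≠ 0} with hBdef
    have hB : ∀ m, MChain.DeterminedBy m (B m) := fun m y y' he hy j h1 h2 =>
      he j h2 ▸ hy j h1 h2
    have hBm : ∀ m, MeasurableSet (embed s0 ⁻¹' B m) := fun m =>
      measurable_embed s0 (hB m).measurableSet
    have hf : Measurable (MChain.hitTime {w : ℕ × S | w.2 = s0}) := MChain.measurable_hitTime _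
    have hfτ : ∀ m, Measurable fun ω : ℕ → ℕ × S =>
        MChain.hitTime {w | w.2 = s0} (MChain.shift (tauSeq s0 ω m) ω) := fun m =>
      hf.comp (measurable_shift_tauSeq s0 m)
    calc ∫⁻ ω, MChain.hitTime {(0, s0)} ω ∂(X.P (0, s0))
        ≤ ∫⁻ ω, ∑' m : ℕ, (embed s0 ⁻¹' B m).indicator (fun ω => MChain.hitTime {w | w.2 = s0}
            (MChain.shift (tauSeq s0 ω m) ω)) ω ∂(X.P (0, s0)) := by
          refine lintegral_mono_ae ?_
          filter_upwards [hG (0, s0), ae_init X (0, s0)] with ω h2 h3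
          exact hitTime_le_tsum h2 (by rw [h3])
      _ = ∑' m : ℕ, ∫⁻ ω in embed s0 ⁻¹' B m, MChain.hitTime {w | w.2 = s0}
            (MChain.shift (tauSeq s0 ω m) ω) ∂(X.P (0, s0)) := by
          rw [lintegral_tsum fun m => ((hfτ m).indicator (hBm m)).aemeasurable]
          exact tsum_congr fun m => lintegral_indicator (hBm m) _
      _ ≤ ∑' m : ℕ, X.P (0, s0) (embed s0 ⁻¹' B m) * M :=
          ENNReal.tsum_le_tsum fun m => lintegral_embed_markov_le X hG _ m (hB m) hf hle
      _ = (∫⁻ ω, ∑' m : ℕ, (embed s0 ⁻¹' B m).indicator 1 ω ∂(X.P (0, s0))) * M := by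
          rw [ENNReal.tsum_mul_right,
            lintegral_tsum fun m => (measurable_one.indicator (hBm m)).aemeasurable]
          congr 1
          exact tsum_congr fun m => (lintegral_indicator_one (hBm m)).symm
      _ ≤ (∫⁻ ω, MChain.hitTime {0} (embed s0 ω) ∂(X.P (0, s0))) * M := by
          gcongr with ω
          exact tsum_indicator_le_hitTime 0 (embed s0 ω)

omit [DecidableEq S] [Nonempty S] in
lemma ae_mem_visitsInfinitelyOften {M : ℝ≥0∞} (hM : M ≠ ⊤)
    (hle : ∀ z, ∫⁻ ω, MChain.hitTime {w | w.2 = s0} ω ∂(X.P z) ≤ M) (z : ℕ × S) :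
    ∀ᵐ ω ∂(X.P z), ω ∈ visitsInfinitelyOften s0 := by
  have hf : Measurable (MChain.hitTime {w : ℕ × S | w.2 = s0}) := MChain.measurable_hitTime _
  have hshift : ∀ n : ℕ, ∀ᵐ ω ∂(X.P z),
      MChain.shift n ω ∈ {ω | MChain.hitTime {w | w.2 = s0} ω < ⊤} := fun n =>
    X.ae_shift n (measurableSet_lt hf measurable_const) fun w =>
      ae_lt_top hf (ne_top_of_le_ne_top hM (hle w))
  filter_upwards [ae_all_iff.2 hshift] with ω hω n
  obtain ⟨k, hk, hs, -⟩ := (MChain.avoids_or_exists_first _ _).resolve_left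
    (mt MChain.hitTime_eq_top.2 (hω n).ne)
  exact ⟨n + k, by omega, hs⟩

end EmbeddedChain

/-- Lemma (embedded chain): under (B_p) for some `p > 1` and (Q_∞), the embedded process
`Y_n = X_{τ_n}` is an irreducible Markov chain on `ℕ`, and `X` is recurrent
(resp. positive-recurrent) if and only if `Y` is. -/
theorem stmt11 (X : MChain (ℕ × S)) (hirr : X.Irreducible) (s0 : S)
    (p : ℝ) (hp : 1 < p) (hB : CondB X p)
    (Q : S → S → ℝ) (pst : S → ℝ) (hQ : CondQ X Q) (hpst : IsStationaryDist Q pst) :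
    ∃ Ychain : MChain ℕ,
      Ychain.Irreducible ∧
      (∀ x : ℕ,
        Measure.map (fun (ω : ℕ → ℕ × S) (n : ℕ) => (ω (tauSeq s0 ω n)).1)
          (X.P (x, s0)) = Ychain.P x) ∧
      (X.Recurrent ↔ Ychain.Recurrent) ∧
      (X.PositiveRecurrent ↔ Ychain.PositiveRecurrent) := by
  have hp0 : 0 < p := zero_lt_one.trans hp
  obtain ⟨M, hM, hle⟩ := exists_lintegral_hitTime_line_le X hirr s0 hp0 hB hQ
  have hG := ae_mem_visitsInfinitelyOften X hM hle
  exact ⟨embeddedChain X hG, embeddedChain_irreducible X hG hirr, fun _ => rfl,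
    recurrent_iff_embeddedChain X hG hirr, positiveRecurrent_iff_embeddedChain X hG hirr hM hle⟩
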